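/- Let n ≥ 1, 1 < q < ∞, and let ω ∈ A_q be a weight on ℝⁿ. Suppose 𝔉 ⊆ L^q(ω dx) satisfies: (i) sup_{f ∈ 𝔉} ‖f‖_{L^q(ω dx)} < ∞; (ii) lim_{y → 0} ‖f(· + y) − f(·)‖_{L^q(ω dx)} = 0 uniformly in f ∈ 𝔉; and (iii) lim_{A → ∞} ∫_{|x| > A} |f(x)|^q ω(x) dx = 0 uniformly in f ∈ 𝔉. Then 𝔉 is relatively compact (pre-compact) in L^q(ω dx). -/

import Mathlib

open MeasureTheory Filter
open scoped ENNReal Topology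

noncomputable section

/-- Euclidean space `ℝⁿ`. -/
abbrev Rn (n : ℕ) := EuclideanSpace ℝ (Fin n)

/-- Axis-parallel closed cube with center `c` and side length `r`. -/
def cube (n : ℕ) (c : Rn n) (r : ℝ) : Set (Rn n) := {y | ∀ i, |y i - c i| ≤ r / 2}

/-- Average of `b` over a set `Q`. -/
def avg (n : ℕ) (b : Rn n → ℝ) (Q : Set (Rn n)) : ℝ :=
  (volume Q).toReal⁻¹ * ∫ x in Q, b x

/-- Mean oscillation of `b` over a set `Q`. -/
def osc (n : ℕ) (b : Rn n → ℝ) (Q : Set (Rn n)) : ℝ :=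
  (volume Q).toReal⁻¹ * ∫ x in Q, |b x - avg n b Q|

/-- The BMO seminorm `‖b‖_*`, as an extended real number (supremum of the mean
oscillations over all cubes). -/
def bmoNorm (n : ℕ) (b : Rn n → ℝ) : ℝ≥0∞ :=
  ⨆ (c : Rn n) (r : {r : ℝ // 0 < r}), ENNReal.ofReal (osc n b (cube n c r.1))

/-- `b ∈ BMO(ℝⁿ)`. -/
def MemBMO (n : ℕ) (b : Rn n → ℝ) : Prop :=
  LocallyIntegrable b volume ∧ bmoNorm n b < ⊤

/-- `b ∈ CMO(ℝⁿ)`: `b` lies in the closure of `C_c^∞(ℝⁿ)` in the BMO seminorm. -/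
def MemCMO (n : ℕ) (b : Rn n → ℝ) : Prop :=
  LocallyIntegrable b volume ∧
  ∀ ε : ℝ, 0 < ε → ∃ g : Rn n → ℝ, ContDiff ℝ (⊤ : ℕ∞) g ∧ HasCompactSupport g ∧
    bmoNorm n (fun x => b x - g x) ≤ ENNReal.ofReal ε

/-- The bilinear fractional integral operator `B_α`. -/
def Bop (n : ℕ) (α : ℝ) (f g : Rn n → ℝ) (x : Rn n) : ℝ :=
  ∫ y, f (x - y) * g (x + y) * ‖y‖ ^ (α - n)

/-- The first commutator `[b, B_α]₁`. -/
def commB (n : ℕ) (α : ℝ) (b f g : Rn n → ℝ) (x : Rn n) : ℝ :=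
  ∫ y, (b x - b y) * f y * g ((2 : ℝ) • x - y) * ‖x - y‖ ^ (α - n)

/-- The bilinear fractional integral operator `I_α`. -/
def Iop (n : ℕ) (α : ℝ) (f₁ f₂ : Rn n → ℝ) (x : Rn n) : ℝ :=
  ∫ y₁, ∫ y₂, f₁ y₁ * f₂ y₂ * (‖x - y₁‖ ^ 2 + ‖x - y₂‖ ^ 2) ^ (α / 2 - n)

/-- The iterated commutator `[Πb⃗, I_α]` with `b⃗ = (b, b)`. -/
def commI (n : ℕ) (α : ℝ) (b f₁ f₂ : Rn n → ℝ) (x : Rn n) : ℝ :=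
  ∫ y₁, ∫ y₂, (b x - b y₁) * (b x - b y₂) * f₁ y₁ * f₂ y₂ *
    (‖x - y₁‖ ^ 2 + ‖x - y₂‖ ^ 2) ^ (α / 2 - n)

/-- The Muckenhoupt class `A_p`. -/
def MemAp (n : ℕ) (p : ℝ) (w : Rn n → ℝ) : Prop :=
  ∃ C : ℝ, ∀ (c : Rn n) (r : ℝ), 0 < r →
    ((volume (cube n c r)).toReal⁻¹ * ∫ x in cube n c r, w x) *
      ((volume (cube n c r)).toReal⁻¹ * ∫ x in cube n c r, w x ^ (-(1 / (p - 1)))) ^ (p - 1) ≤ C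

/-- The bilinear weight class `A_{P,q}` with `P = (p₁, p₂)`. -/
def MemAPq (n : ℕ) (p₁ p₂ q : ℝ) (w₁ w₂ : Rn n → ℝ) : Prop :=
  ∃ C : ℝ, ∀ (c : Rn n) (r : ℝ), 0 < r →
    ((volume (cube n c r)).toReal⁻¹ * ∫ x in cube n c r, w₁ x ^ q * w₂ x ^ q) *
      ((volume (cube n c r)).toReal⁻¹ *
          ∫ x in cube n c r, w₁ x ^ (-(1 - 1 / p₁)⁻¹)) ^ (q * (1 - 1 / p₁)) *
      ((volume (cube n c r)).toReal⁻¹ *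
          ∫ x in cube n c r, w₂ x ^ (-(1 - 1 / p₂)⁻¹)) ^ (q * (1 - 1 / p₂)) ≤ C

/-- A bounded subset of a real normed space that is approximated arbitrarily well by
finite-dimensional subspaces is totally bounded. -/
theorem totallyBounded_of_finiteDimensional_approx {X : Type*} [NormedAddCommGroup X]
    [NormedSpace ℝ X] {F : Set X} {M : ℝ} (hM : ∀ f ∈ F, ‖f‖ ≤ M)
    (hF : ∀ ε : ℝ, 0 < ε → ∃ V : Submodule ℝ X, FiniteDimensional ℝ V ∧
      ∀ f ∈ F, ∃ v ∈ V, dist f v ≤ ε) : TotallyBounded F := by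
  rw [Metric.totallyBounded_iff]
  intro ε hε
  obtain ⟨V, hV, h⟩ := hF (ε / 2) (half_pos hε)
  have : ProperSpace V := FiniteDimensional.proper ℝ V
  have hK : IsCompact (((↑) : V → X) '' Metric.closedBall 0 (M + ε / 2)) :=
    (isCompact_closedBall _ _).image continuous_subtype_val
  obtain ⟨t, -, ht, hcov⟩ := hK.finite_cover_balls (half_pos hε)
  refine ⟨t, ht, fun f hf => ?_⟩
  obtain ⟨v, hvV, hv⟩ := h f hf
  have hvn : ‖v‖ ≤ M + ε / 2 := by
    have h1 := norm_le_norm_add_norm_sub f v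
    rw [← dist_eq_norm] at h1
    linarith [hM f hf]
  have hvK : v ∈ ((↑) : V → X) '' Metric.closedBall 0 (M + ε / 2) :=
    ⟨⟨v, hvV⟩, by simpa using hvn, rfl⟩
  obtain ⟨y, hy, hvy⟩ := Set.mem_iUnion₂.1 (hcov hvK)
  refine Set.mem_iUnion₂.2 ⟨y, hy, ?_⟩
  rw [Metric.mem_ball] at hvy ⊢
  linarith [dist_triangle f v y]

/-- A compact set can be partitioned into finitely many measurable pieces, each contained in a ball
of prescribed radius. -/
theorem IsCompact.exists_measurable_partition_subset_ball {E : Type*} [PseudoMetricSpace E]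
    [T2Space E] [MeasurableSpace E] [BorelSpace E] {K : Set E} (hK : IsCompact K) {r : ℝ}
    (hr : 0 < r) : ∃ (m : ℕ) (P : Fin m → Set E) (z : Fin m → E), (∀ i, MeasurableSet (P i)) ∧
      Pairwise (Function.onFun Disjoint P) ∧ ⋃ i, P i = K ∧ ∀ i, P i ⊆ Metric.ball (z i) r := by
  obtain ⟨t, -, ht, hcov⟩ := hK.finite_cover_balls hr
  obtain ⟨m, z, -, rfl⟩ := ht.fin_param
  have hsub : ∀ i, disjointed (fun i => K ∩ Metric.ball (z i) r) i ⊆ K ∩ Metric.ball (z i) r :=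
    disjointed_subset _
  refine ⟨m, disjointed fun i => K ∩ Metric.ball (z i) r, z, fun i => ?_, disjoint_disjointed _,
    ?_, fun i => (hsub i).trans Set.inter_subset_right⟩
  · exact disjointedRec (p := MeasurableSet)
      (fun _ j h => h.diff (hK.measurableSet.inter measurableSet_ball))
      (hK.measurableSet.inter measurableSet_ball)
  · rw [iUnion_disjointed, ← Set.inter_iUnion, Set.inter_eq_left]
    simpa using hcov

section Translation

variable {E : Type*} [NormedAddCommGroup E] [NormedSpace ℝ E] [FiniteDimensional ℝ E]
  [MeasurableSpace E] [BorelSpace E] {ν μ : Measure E} [ν.IsAddHaarMeasure] [SFinite μ]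

/-- On a set contained in a ball of radius `r`, a function is approximated by one of its values
with an error controlled by its translates by vectors of norm less than `2 * r`. -/
theorem exists_mul_setLIntegral_sub_const_le {g : E → ℝ} (hg : Measurable g) {q : ℝ} {z : E}
    {r : ℝ} (hr : 0 < r) {P : Set E} (hP : MeasurableSet P) (hPz : P ⊆ Metric.ball z r) :
    ∃ c : ℝ, ν (Metric.ball 0 r) * ∫⁻ x in P, ‖g x - c‖ₑ ^ q ∂μ ≤
      ∫⁻ x in P, ∫⁻ y in Metric.ball 0 (2 * r), ‖g (x + y) - g x‖ₑ ^ q ∂ν ∂μ := by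
  have hmeas : Measurable (Function.uncurry fun a x : E => ‖g x - g a‖ₑ ^ q) := by
    unfold Function.uncurry
    fun_prop
  have hν0 : ν (Metric.ball z r) ≠ 0 := (Metric.measure_ball_pos ν z hr).ne'
  have hνtop : ν (Metric.ball z r) ≠ ∞ := measure_ball_lt_top.ne
  obtain ⟨a, -, ha⟩ := exists_le_setLAverage (μ := ν) (s := Metric.ball z r)
    (f := fun a => ∫⁻ x in P, ‖g x - g a‖ₑ ^ q ∂μ) hν0 hνtop
    (Measurable.lintegral_prod_right' hmeas).aemeasurable
  refine ⟨g a, ?_⟩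
  calc ν (Metric.ball 0 r) * ∫⁻ x in P, ‖g x - g a‖ₑ ^ q ∂μ
      ≤ ν (Metric.ball z r) *
          ⨍⁻ a in Metric.ball z r, (∫⁻ x in P, ‖g x - g a‖ₑ ^ q ∂μ) ∂ν := by
        rw [Measure.addHaar_ball_center ν z r]
        gcongr
    _ = ∫⁻ a in Metric.ball z r, ∫⁻ x in P, ‖g x - g a‖ₑ ^ q ∂μ ∂ν := by
        rw [measure_mul_setLAverage _ hνtop]
    _ = ∫⁻ x in P, ∫⁻ a in Metric.ball z r, ‖g x - g a‖ₑ ^ q ∂ν ∂μ :=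
        lintegral_lintegral_swap hmeas.aemeasurable
    _ ≤ ∫⁻ x in P, ∫⁻ y in Metric.ball 0 (2 * r), ‖g (x + y) - g x‖ₑ ^ q ∂ν ∂μ := by
        refine setLIntegral_mono' hP fun x hx => ?_
        rw [← lintegral_indicator measurableSet_ball, ← lintegral_indicator measurableSet_ball,
          ← lintegral_add_left_eq_self _ x]
        refine lintegral_mono fun y => Set.indicator_apply_le' (fun hy => ?_) fun _ => zero_le
        have hy' : y ∈ Metric.ball (0 : E) (2 * r) := by
          have h1 := Metric.mem_ball.1 hy
          have h2 := Metric.mem_ball.1 (hPz hx)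
          have h3 := dist_triangle_right (x + y) x z
          rw [mem_ball_zero_iff]
          rw [dist_self_add_left] at h3
          linarith
        rw [Set.indicator_of_mem hy', ← enorm_neg, neg_sub]

/-- A function whose translates by vectors of norm less than `2 * r` are close to it is close to a
step function subordinate to any given finite partition into sets contained in balls of
radius `r`. -/
theorem exists_mul_setLIntegral_sub_step_le {g : E → ℝ} (hg : Measurable g) {q r : ℝ}
    (hr : 0 < r) {m : ℕ} {P : Fin m → Set E} {z : Fin m → E} (hP : ∀ i, MeasurableSet (P i))
    (hdisj : Pairwise (Function.onFun Disjoint P)) (hPz : ∀ i, P i ⊆ Metric.ball (z i) r)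
    {η : ℝ≥0∞} (hη : ∀ y : E, ‖y‖ < 2 * r → ∫⁻ x, ‖g (x + y) - g x‖ₑ ^ q ∂μ ≤ η) :
    ∃ c : Fin m → ℝ, ν (Metric.ball 0 r) *
      ∫⁻ x in ⋃ i, P i, ‖g x - ∑ i, (P i).indicator (fun _ => c i) x‖ₑ ^ q ∂μ ≤
        ν (Metric.ball 0 (2 * r)) * η := by
  choose c hc using fun i =>
    exists_mul_setLIntegral_sub_const_le (ν := ν) (μ := μ) (q := q) hg hr (hP i) (hPz i)
  have hmeas : Measurable (Function.uncurry fun x y : E => ‖g (x + y) - g x‖ₑ ^ q) := by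
    unfold Function.uncurry
    fun_prop
  refine ⟨c, ?_⟩
  rw [lintegral_iUnion hP hdisj, ← ENNReal.tsum_mul_left]
  calc _ ≤ ∑' i, ∫⁻ x in P i, ∫⁻ y in Metric.ball 0 (2 * r), ‖g (x + y) - g x‖ₑ ^ q ∂ν ∂μ := by
        refine ENNReal.tsum_le_tsum fun i => le_trans (le_of_eq ?_) (hc i)
        congr 1
        refine setLIntegral_congr_fun (hP i) fun x hx => ?_
        have hstep : ∑ j, (P j).indicator (fun _ => c j) x = c i := by
          rw [Finset.sum_eq_single i (fun j _ hj => Set.indicator_of_notMem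
            (Set.disjoint_right.1 (hdisj hj) hx) _) (by simp), Set.indicator_of_mem hx]
        simp only [hstep]
    _ = ∫⁻ x in ⋃ i, P i, ∫⁻ y in Metric.ball 0 (2 * r), ‖g (x + y) - g x‖ₑ ^ q ∂ν ∂μ :=
        (lintegral_iUnion hP hdisj _).symm
    _ ≤ ∫⁻ x, ∫⁻ y in Metric.ball 0 (2 * r), ‖g (x + y) - g x‖ₑ ^ q ∂ν ∂μ :=
        setLIntegral_le_lintegral _ _
    _ = ∫⁻ y in Metric.ball 0 (2 * r), ∫⁻ x, ‖g (x + y) - g x‖ₑ ^ q ∂μ ∂ν :=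
        lintegral_lintegral_swap hmeas.aemeasurable
    _ ≤ ∫⁻ _ in Metric.ball (0 : E) (2 * r), η ∂ν :=
        setLIntegral_mono' measurableSet_ball fun y hy => hη y (mem_ball_zero_iff.1 hy)
    _ = ν (Metric.ball 0 (2 * r)) * η := by rw [setLIntegral_const, mul_comm]

/-- The Fréchet–Kolmogorov–Riesz criterion in `L^q(μ)`, for an arbitrary locally finite measure
`μ`: no relation between `μ` and Haar measure is needed. -/
theorem totallyBounded_of_translation_of_tail [IsLocallyFiniteMeasure μ] {q : ℝ} (hq : 0 < q)
    [Fact (1 ≤ ENNReal.ofReal q)] {F : Set (Lp ℝ (ENNReal.ofReal q) μ)}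
    (hbd : ∃ M : ℝ, ∀ f ∈ F, ‖f‖ ≤ M)
    (htrans : ∀ ε : ℝ, 0 < ε → ∃ δ : ℝ, 0 < δ ∧ ∀ y : E, ‖y‖ < δ → ∀ f ∈ F,
      eLpNorm (fun x => f (x + y) - f x) (ENNReal.ofReal q) μ ≤ ENNReal.ofReal ε)
    (htail : ∀ ε : ℝ, 0 < ε → ∃ A : ℝ, ∀ f ∈ F, ∫ x in {x : E | A < ‖x‖}, |f x| ^ q ∂μ ≤ ε) :
    TotallyBounded F := by
  have : ProperSpace E := FiniteDimensional.proper ℝ E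
  have hq0 : ENNReal.ofReal q ≠ 0 := by simpa using hq
  have hpow : ∀ f : E → ℝ, eLpNorm f (ENNReal.ofReal q) μ ^ q = ∫⁻ x, ‖f x‖ₑ ^ q ∂μ := fun f => by
    rw [eLpNorm_eq_lintegral_rpow_enorm_toReal hq0 ENNReal.ofReal_ne_top,
      ENNReal.toReal_ofReal hq.le, ← ENNReal.rpow_mul, one_div_mul_cancel hq.ne', ENNReal.rpow_one]
  obtain ⟨M, hM⟩ := hbd
  refine totallyBounded_of_finiteDimensional_approx hM fun ε hε => ?_
  set d := Module.finrank ℝ E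
  set η : ℝ := ε ^ q / 2 / 2 ^ d
  have hηpos : 0 < η := by positivity
  obtain ⟨δ, hδ, hδF⟩ := htrans (η ^ (1 / q)) (by positivity)
  obtain ⟨A, hA⟩ := htail (ε ^ q / 2) (by positivity)
  have hr : 0 < δ / 2 := half_pos hδ
  obtain ⟨m, P, z, hP, hdisj, hunion, hPz⟩ :=
    (isCompact_closedBall (0 : E) A).exists_measurable_partition_subset_ball hr
  have hPfin : ∀ i, μ (P i) ≠ ∞ := fun i => ((measure_mono (hunion ▸ Set.subset_iUnion P i)).trans_lt
    (isCompact_closedBall (0 : E) A).measure_lt_top).ne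
  let b : Fin m → Lp ℝ (ENNReal.ofReal q) μ := fun i =>
    indicatorConstLp (ENNReal.ofReal q) (hP i) (hPfin i) 1
  refine ⟨Submodule.span ℝ (Set.range b),
    FiniteDimensional.span_of_finite ℝ (Set.finite_range b), fun f hf => ?_⟩
  have hη : ∀ y : E, ‖y‖ < 2 * (δ / 2) →
      ∫⁻ x, ‖f (x + y) - f x‖ₑ ^ q ∂μ ≤ ENNReal.ofReal η := fun y hy => by
    rw [← hpow]
    refine (ENNReal.rpow_le_rpow (hδF y (by linarith) f hf) hq.le).trans_eq ?_
    rw [ENNReal.ofReal_rpow_of_pos (by positivity), ← Real.rpow_mul hηpos.le,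
      one_div_mul_cancel hq.ne', Real.rpow_one]
  obtain ⟨c, hc⟩ := exists_mul_setLIntegral_sub_step_le (ν := Measure.addHaar)
    (Lp.stronglyMeasurable f).measurable hr hP hdisj hPz hη
  rw [Measure.addHaar_ball_mul_of_pos _ _ zero_lt_two, mul_comm (ENNReal.ofReal _), mul_assoc,
    ENNReal.mul_le_mul_iff_right (Metric.measure_ball_pos _ _ hr).ne' measure_ball_lt_top.ne,
    ← ENNReal.ofReal_mul (by positivity), hunion, mul_div_cancel₀ _ (by positivity)] at hc
  refine ⟨∑ i, c i • b i, Submodule.sum_mem _ fun i _ =>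
    Submodule.smul_mem _ _ (Submodule.subset_span ⟨i, rfl⟩), ?_⟩
  have hv : ⇑(f - ∑ i, c i • b i) =ᵐ[μ]
      fun x => f x - ∑ i, (P i).indicator (fun _ => c i) x := by
    have h1 : ∀ᵐ x ∂μ, ∀ i, (c i • b i : Lp ℝ (ENNReal.ofReal q) μ) x =
        (P i).indicator (fun _ => c i) x := by
      refine ae_all_iff.2 fun i => ?_
      filter_upwards [Lp.coeFn_smul (c i) (b i),
        indicatorConstLp_coeFn (p := ENNReal.ofReal q) (hs := hP i) (hμs := hPfin i) (c := (1 : ℝ))]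
        with x h2 h3
      rw [h2, Pi.smul_apply, h3]
      by_cases hx : x ∈ P i <;> simp [hx]
    filter_upwards [Lp.coeFn_sub f (∑ i, c i • b i),
      Lp.coeFn_finsetSum Finset.univ (fun i => c i • b i), h1] with x h2 h3 h4
    rw [h2, Pi.sub_apply, h3, Finset.sum_apply]
    simp only [h4]
  have htailf : ∫⁻ x in (Metric.closedBall (0 : E) A)ᶜ,
      ‖f x - ∑ i, (P i).indicator (fun _ => c i) x‖ₑ ^ q ∂μ ≤ ENNReal.ofReal (ε ^ q / 2) := by
    have hset : (Metric.closedBall (0 : E) A)ᶜ = {x : E | A < ‖x‖} := by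
      ext x
      simp
    have hint : Integrable (fun x => |f x| ^ q) μ := by
      have := (Lp.memLp f).integrable_norm_rpow hq0 ENNReal.ofReal_ne_top
      simpa only [ENNReal.toReal_ofReal hq.le, Real.norm_eq_abs] using this
    refine le_trans (le_of_eq ?_) (ENNReal.ofReal_le_ofReal (hA f hf))
    rw [ofReal_integral_eq_lintegral_ofReal hint.restrict (ae_of_all _ fun x => by positivity),
      ← hset]
    refine setLIntegral_congr_fun measurableSet_closedBall.compl fun x hx => ?_
    have hx' : ∀ i, x ∉ P i := fun i hi => hx (hunion ▸ Set.mem_iUnion_of_mem i hi)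
    simp only [Set.indicator_of_notMem (hx' _), Finset.sum_const_zero, sub_zero]
    rw [← ENNReal.ofReal_rpow_of_nonneg (abs_nonneg _) hq.le, ← Real.norm_eq_abs,
      ofReal_norm]
  rw [dist_eq_norm, Lp.norm_def]
  refine ENNReal.toReal_le_of_le_ofReal hε.le ((ENNReal.rpow_le_rpow_iff hq).1 ?_)
  rw [eLpNorm_congr_ae hv, hpow,
    ← lintegral_add_compl _ (measurableSet_closedBall (x := (0 : E)) (ε := A)),
    ENNReal.ofReal_rpow_of_pos hε, ← add_halves (ε ^ q),
    ENNReal.ofReal_add (by positivity) (by positivity)]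
  exact add_le_add hc htailf

end Translation

/-- weighted Fréchet–Kolmogorov–Riesz: a uniformly bounded,
uniformly translation-continuous family in `L^q(ω dx)` with uniformly small tails,
where `ω ∈ A_q`, is relatively compact. -/
theorem statement15 (n : ℕ) (hn : 1 ≤ n) (q : ℝ) (hq1 : 1 < q)
    [Fact (1 ≤ ENNReal.ofReal q)]
    (ω : Rn n → ℝ) (hω0 : ∀ x, 0 ≤ ω x) (hωloc : LocallyIntegrable ω volume)
    (hA : MemAp n q ω)
    (F : Set (Lp ℝ (ENNReal.ofReal q) (volume.withDensity fun x => ENNReal.ofReal (ω x))))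
    (hbd : ∃ M : ℝ, ∀ f ∈ F, ‖f‖ ≤ M)
    (htrans : ∀ ε : ℝ, 0 < ε → ∃ δ : ℝ, 0 < δ ∧ ∀ y : Rn n, ‖y‖ < δ → ∀ f ∈ F,
      eLpNorm (fun x => (f : Rn n → ℝ) (x + y) - (f : Rn n → ℝ) x) (ENNReal.ofReal q)
          (volume.withDensity fun x => ENNReal.ofReal (ω x)) ≤ ENNReal.ofReal ε)
    (htail : ∀ ε : ℝ, 0 < ε → ∃ A : ℝ, ∀ f ∈ F,
      ∫ x in {x : Rn n | A < ‖x‖}, |(f : Rn n → ℝ) x| ^ q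
          ∂(volume.withDensity fun x => ENNReal.ofReal (ω x)) ≤ ε) :
    IsCompact (closure F) := by
  have hloc : IsLocallyFiniteMeasure (volume.withDensity fun x => ENNReal.ofReal (ω x)) := by
    refine ⟨fun x => ?_⟩
    obtain ⟨s, hs, hint⟩ := hωloc x
    obtain ⟨t, hts, ht, hxt⟩ := mem_nhds_iff.1 hs
    refine ⟨t, ht.mem_nhds hxt, ?_⟩
    rw [withDensity_apply _ ht.measurableSet]
    refine lt_of_le_of_lt (lintegral_mono fun x => ?_) (hint.mono_set hts).2
    exact Real.ofReal_le_enorm _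
  exact isCompact_iff_totallyBounded_isComplete.2
    ⟨(totallyBounded_of_translation_of_tail (zero_lt_one.trans hq1) hbd htrans htail).closure,
      isClosed_closure.isComplete⟩
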